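/- Take characteristics (m₀, m₁, m₂, m₃) = (1,0,0,0) (so N = 3, N(N−2m₀−1) = 0, ρ = 3b² − 2(a+1)b + a) and assume 3b⁴ − 4(a+1)b³ + 6ab² − a² = 0. Then for every λ ∈ ℂ the function Ψ(λ, z) = (z−b)²λ + z³ + 3(1+a−4b)z² + (2a − 10ab − 10b + 27b²)z + 2ab + 3ab² + 3b² − 12b³ satisfies the third-order equation Ψ''' + 3P·Ψ'' + (P' + 4Q + 2P²)·Ψ' + (2Q' + 4P·Q)·Ψ = 0 at every z ∈ ℂ ∖ {0, 1, a, b} (derivatives in z). -/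

import Mathlib

/-- Coefficient `P(z)` of the five-singular-point Fuchsian equation with singular points
`0, 1, a, b, ∞` and characteristics `(m₀, m₁, m₂, m₃; n₁ = 1)`. -/
noncomputable def Pcoef (m₁ m₂ m₃ : ℕ) (a b z : ℂ) : ℂ :=
  (1/2) * ((1 - 2*(m₁:ℂ))/z + (1 - 2*(m₂:ℂ))/(z-1) + (1 - 2*(m₃:ℂ))/(z-a)) - 2/(z-b)

/-- Coefficient `Q(z)` of the five-singular-point Fuchsian equation, with
`N = m₀ + m₁ + m₂ + m₃ + 2` and
`ρ = 2(b−1)(b−a)m₁ + 2b(b−a)m₂ + 2b(b−1)m₃ + 3b² − 2(a+1)b + a`. -/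
noncomputable def Qcoef (m₀ m₁ m₂ m₃ : ℕ) (a b lam z : ℂ) : ℂ :=
  (((m₀:ℂ) + (m₁:ℂ) + (m₂:ℂ) + (m₃:ℂ) + 2)
      * (((m₀:ℂ) + (m₁:ℂ) + (m₂:ℂ) + (m₃:ℂ) + 2) - 2*(m₀:ℂ) - 1) * z
    + lam
    + 2*(2*(b-1)*(b-a)*(m₁:ℂ) + 2*b*(b-a)*(m₂:ℂ) + 2*b*(b-1)*(m₃:ℂ)
          + 3*b^2 - 2*(a+1)*b + a) / (z-b))
  / (4*z*(z-1)*(z-a))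

/-- The third-order equation `Ψ''' + 3P·Ψ'' + (P' + 4Q + 2P²)·Ψ' + (2Q' + 4P·Q)·Ψ = 0`
satisfied by products of pairs of solutions of `y'' + P·y' + Q·y = 0`. -/
def ThirdOrderODE (P Q Ψ : ℂ → ℂ) (z : ℂ) : Prop :=
  deriv (deriv (deriv Ψ)) z + 3 * P z * deriv (deriv Ψ) z
    + (deriv P z + 4 * Q z + 2 * (P z)^2) * deriv Ψ z
    + (2 * deriv Q z + 4 * P z * Q z) * Ψ z = 0

theorem hasDerivAt_Pcoef_zero {a b z : ℂ} (h0 : z ≠ 0) (h1 : z ≠ 1) (ha : z ≠ a) (hb : z ≠ b) :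
    HasDerivAt (Pcoef 0 0 0 a b)
      (-(1/2) * (1/z^2 + 1/(z-1)^2 + 1/(z-a)^2) + 2/(z-b)^2) z := by
  have d (c : ℂ) : HasDerivAt (fun t : ℂ => t - c) 1 z := (hasDerivAt_id z).sub_const c
  unfold Pcoef
  convert! (((((hasDerivAt_const z (1 - 2*((0:ℕ):ℂ))).div (hasDerivAt_id z) h0).add
    ((hasDerivAt_const z (1 - 2*((0:ℕ):ℂ))).div (d 1) (sub_ne_zero.2 h1))).add
    ((hasDerivAt_const z (1 - 2*((0:ℕ):ℂ))).div (d a) (sub_ne_zero.2 ha))).const_mul (1/2)).sub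
    ((hasDerivAt_const z (2:ℂ)).div (d b) (sub_ne_zero.2 hb)) using 1
  simp only [id, Nat.cast_zero]
  ring

theorem hasDerivAt_Qcoef_one {a b lam z : ℂ} (h0 : z ≠ 0) (h1 : z ≠ 1) (ha : z ≠ a) (hb : z ≠ b) :
    HasDerivAt (Qcoef 1 0 0 0 a b lam)
      (-(2*(3*b^2 - 2*(a+1)*b + a)) / (z-b)^2 / (4*z*(z-1)*(z-a))
        - (lam + 2*(3*b^2 - 2*(a+1)*b + a) / (z-b)) * (4*(3*z^2 - 2*(a+1)*z + a))
          / (4*z*(z-1)*(z-a))^2) z := by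
  have d (c : ℂ) : HasDerivAt (fun t : ℂ => t - c) 1 z := (hasDerivAt_id z).sub_const c
  have h1' := sub_ne_zero.2 h1
  have ha' := sub_ne_zero.2 ha
  have hb' := sub_ne_zero.2 hb
  have hD : 4*z*(z-1)*(z-a) ≠ 0 := by simp [h0, h1', ha']
  have hQ : Qcoef 1 0 0 0 a b lam = fun t =>
      (lam + 2*(3*b^2 - 2*(a+1)*b + a) / (t-b)) / (4*t*(t-1)*(t-a)) := by
    funext t
    simp only [Qcoef, Nat.cast_zero, Nat.cast_one]
    ring
  rw [hQ]
  convert! (((hasDerivAt_const z (2*(3*b^2 - 2*(a+1)*b + a))).div (d b) hb').const_add lam).div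
    ((((hasDerivAt_id z).const_mul (4:ℂ)).mul (d 1)).mul (d a))
    hD using 1
  simp only [id, Pi.mul_apply, Pi.div_apply]
  field_simp
  ring

theorem deriv_cubic (c₃ c₂ c₁ c₀ : ℂ) :
    deriv (fun t : ℂ => c₃*t^3 + c₂*t^2 + c₁*t + c₀)
      = fun t => 0*t^3 + 3*c₃*t^2 + 2*c₂*t + c₁ := by
  funext t
  refine HasDerivAt.deriv ?_
  convert! ((((hasDerivAt_pow 3 t).const_mul c₃).add ((hasDerivAt_pow 2 t).const_mul c₂)).add
    ((hasDerivAt_id t).const_mul c₁)).add_const c₀ using 1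
  norm_num
  ring

theorem fuchsian_psi_1000_quartic (a b : ℂ) (ha0 : a ≠ 0) (ha1 : a ≠ 1) (hb0 : b ≠ 0) (hb1 : b ≠ 1) (hba : b ≠ a)
    (hb : 3*b^4 - 4*(a+1)*b^3 + 6*a*b^2 - a^2 = 0) :
    ∀ lam : ℂ, ∀ z : ℂ, z ≠ 0 → z ≠ 1 → z ≠ a → z ≠ b →
      ThirdOrderODE (Pcoef 0 0 0 a b) (Qcoef 1 0 0 0 a b lam)
        (fun t => (t - b)^2 * lam + t^3 + 3*(1 + a - 4*b) * t^2
          + (2*a - 10*a*b - 10*b + 27*b^2) * t + 2*a*b + 3*a*b^2 + 3*b^2 - 12*b^3) z := by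
  intro lam z h0 h1 ha hbz
  have hz1 := sub_ne_zero.2 h1
  have hza := sub_ne_zero.2 ha
  have hzb := sub_ne_zero.2 hbz
  have hΨ : (fun t : ℂ => (t - b)^2 * lam + t^3 + 3*(1 + a - 4*b) * t^2
      + (2*a - 10*a*b - 10*b + 27*b^2) * t + 2*a*b + 3*a*b^2 + 3*b^2 - 12*b^3)
      = fun t => 1*t^3 + (lam + 3*(1 + a - 4*b)) * t^2
        + (-2*b*lam + (2*a - 10*a*b - 10*b + 27*b^2)) * t
        + (b^2*lam + 2*a*b + 3*a*b^2 + 3*b^2 - 12*b^3) := by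
    funext t
    ring
  rw [hΨ]
  simp only [ThirdOrderODE, deriv_cubic, (hasDerivAt_Pcoef_zero h0 h1 ha hbz).deriv,
    (hasDerivAt_Qcoef_one h0 h1 ha hbz).deriv, Pcoef, Qcoef, Nat.cast_zero, Nat.cast_one]
  trans -6 / (z*(z-1)*(z-a)*(z-b)) * (3*b^4 - 4*(a+1)*b^3 + 6*a*b^2 - a^2)
  swap
  · rw [hb, mul_zero]
  field_simp
  ring
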